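/- arXiv:2108.00191 — 2 statements merged into one kernel-verified Lean document; each statement's English description precedes it below -/
import Mathlib

section
/- Let k ≥ 2 be an integer and let a, b be positive integers. Then p_{-k}(a) · p_{-k}(b) > p_{-k}(a+b), except when (a, b, k) is one of (1,1,2), (1,2,2), (2,1,2), (1,3,2), (3,1,2), (1,1,3). -/
/-- Sum of divisors function. -/
def mysigma (n : ℕ) : ℕ := ∑ d ∈ n.divisors, d

/-- Partition function: number of partitions of `n`. -/
def partcount (n : ℕ) : ℕ := Fintype.card (Nat.Partition n)

/-- D'Arcais polynomials as real functions. -/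
noncomputable def P : ℕ → ℝ → ℝ
  | 0 => fun _ => 1
  | n + 1 => fun x => x / (n + 1) * ∑ k ∈ Finset.range (n + 1), (mysigma (k + 1) : ℝ) * P (n - k) x

/-- Number of k-colored partitions of n (each part in one of k colors),
counted via splitting into one ordinary partition per color. -/
def pcolored : ℕ → ℕ → ℕ
  | 0, n => if n = 0 then 1 else 0
  | k + 1, n => ∑ j ∈ Finset.range (n + 1), pcolored k j * partcount (n - j)

theorem card_filter_le_count_parts (n d m : ℕ) (hd : 0 < d) :
    (Finset.univ.filter fun l : Nat.Partition n => m ≤ l.parts.count d).card =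
      if d * m ≤ n then partcount (n - d * m) else 0 := by
  have sum_le (l : Nat.Partition n) (hl : Multiset.replicate m d ≤ l.parts) : d * m ≤ n := by
    obtain ⟨u, hu⟩ := Multiset.le_iff_exists_add.mp hl
    have := l.parts_sum
    rw [hu, Multiset.sum_add, Multiset.sum_replicate, smul_eq_mul] at this
    rw [mul_comm]
    omega
  split_ifs with h
  · rw [partcount, ← Finset.card_univ]
    refine Finset.card_bij' (fun l hl => ⟨l.parts - Multiset.replicate m d, fun hi =>
        l.parts_pos (Multiset.mem_of_le tsub_le_self hi), ?_⟩)
      (fun l _ => ⟨l.parts + Multiset.replicate m d, ?_, ?_⟩) ?_ ?_ ?_ ?_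
    · rw [Finset.mem_filter, Multiset.le_count_iff_replicate_le] at hl
      have := congrArg Multiset.sum (tsub_add_cancel_of_le hl.2)
      rw [Multiset.sum_add, Multiset.sum_replicate, l.parts_sum, smul_eq_mul, mul_comm m d] at this
      omega
    · intro i hi
      rcases Multiset.mem_add.mp hi with hi | hi
      · exact l.parts_pos hi
      · rwa [Multiset.eq_of_mem_replicate hi]
    · rw [Multiset.sum_add, Multiset.sum_replicate, l.parts_sum, smul_eq_mul, mul_comm m d]
      omega
    · simp
    · simp
    · intro l hl
      rw [Finset.mem_filter, Multiset.le_count_iff_replicate_le] at hl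
      exact Nat.Partition.ext (tsub_add_cancel_of_le hl.2)
    · intro l _
      exact Nat.Partition.ext (add_tsub_cancel_right _ _)
  · rw [Finset.card_eq_zero, Finset.filter_eq_empty_iff]
    intro l _ hl
    exact h (sum_le l (Multiset.le_count_iff_replicate_le.mp hl))

theorem sum_parts_eq_sum_indicator {n : ℕ} (l : Nat.Partition n) :
    n = ∑ d ∈ Finset.Icc 1 n, ∑ m ∈ Finset.Icc 1 n, if m ≤ l.parts.count d then d else 0 := by
  have count_le (d : ℕ) (hd : d ∈ Finset.Icc 1 n) : l.parts.count d ≤ n := by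
    have hc := Multiset.count_le_card d l.parts
    have hs := Multiset.card_nsmul_le_sum (s := l.parts) (a := 1) fun i hi => l.parts_pos hi
    rw [l.parts_sum, smul_eq_mul, mul_one] at hs
    exact hc.trans hs
  have hsub : l.parts.toFinset ⊆ Finset.Icc 1 n := fun i hi => by
    rw [Multiset.mem_toFinset] at hi
    exact Finset.mem_Icc.mpr ⟨l.parts_pos hi, Nat.Partition.le_of_mem_parts hi⟩
  calc n = l.parts.sum := l.parts_sum.symm
    _ = ∑ d ∈ Finset.Icc 1 n, l.parts.count d • d :=
      Finset.sum_multiset_count_of_subset _ _ hsub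
    _ = _ := Finset.sum_congr rfl fun d hd => by
      rw [← Finset.sum_filter, Finset.sum_const]
      congr 1
      have : (Finset.Icc 1 n).filter (fun m => m ≤ l.parts.count d) =
          Finset.Icc 1 (l.parts.count d) := by
        ext m
        have := count_le d hd
        simp only [Finset.mem_filter, Finset.mem_Icc]
        omega
      simp [this]

theorem mysigma_eq_sum_sum_ite {n t : ℕ} (ht : t ∈ Finset.Icc 1 n) :
    mysigma t = ∑ d ∈ Finset.Icc 1 n, ∑ m ∈ Finset.Icc 1 n, if d * m = t then d else 0 := by
  rw [Finset.mem_Icc] at ht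
  have hsub : t.divisors ⊆ Finset.Icc 1 n := fun d hd => Finset.mem_Icc.mpr
    ⟨Nat.pos_of_mem_divisors hd, (Nat.divisor_le hd).trans ht.2⟩
  rw [mysigma, ← Finset.sum_subset hsub
    (f := fun d => ∑ m ∈ Finset.Icc 1 n, if d * m = t then d else 0)]
  · refine Finset.sum_congr rfl fun d hd => ?_
    have hdt := Nat.mul_div_cancel' (Nat.dvd_of_mem_divisors hd)
    have hd0 := Nat.pos_of_mem_divisors hd
    rw [Finset.sum_eq_single (t / d)]
    · rw [if_pos hdt]
    · intro m _ hm
      exact if_neg fun h => hm (Nat.eq_of_mul_eq_mul_left hd0 (h.trans hdt.symm))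
    · intro h
      refine absurd (Finset.mem_Icc.mpr ⟨?_, (Nat.div_le_self _ _).trans ht.2⟩) h
      exact Nat.div_pos (Nat.divisor_le hd) hd0
  · intro d _ hd
    refine Finset.sum_eq_zero fun m _ => if_neg fun h => hd ?_
    exact Nat.mem_divisors.mpr ⟨⟨m, h.symm⟩, by omega⟩

/-- Euler's recurrence for the partition function. -/
theorem mul_partcount_eq_sum (n : ℕ) :
    n * partcount n = ∑ p ∈ Finset.HasAntidiagonal.antidiagonal n, mysigma p.1 * partcount p.2 := by
  calc n * partcount n = ∑ _l : Nat.Partition n, n := by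
        rw [Finset.sum_const, smul_eq_mul, mul_comm, partcount, Finset.card_univ]
    _ = ∑ l : Nat.Partition n, ∑ d ∈ Finset.Icc 1 n, ∑ m ∈ Finset.Icc 1 n,
          if m ≤ l.parts.count d then d else 0 :=
        Finset.sum_congr rfl fun l _ => sum_parts_eq_sum_indicator l
    _ = ∑ d ∈ Finset.Icc 1 n, ∑ m ∈ Finset.Icc 1 n,
          ∑ t ∈ Finset.Icc 1 n, if d * m = t then d * partcount (n - t) else 0 := by
        rw [Finset.sum_comm]
        refine Finset.sum_congr rfl fun d hd => ?_
        rw [Finset.sum_comm]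
        refine Finset.sum_congr rfl fun m hm => ?_
        rw [Finset.mem_Icc] at hd hm
        rw [← Finset.sum_filter, Finset.sum_const, smul_eq_mul,
          card_filter_le_count_parts n d m hd.1, Finset.sum_ite_eq]
        have := Nat.mul_pos hd.1 hm.1
        by_cases h : d * m ≤ n
        · rw [if_pos h, if_pos (Finset.mem_Icc.mpr ⟨this, h⟩), mul_comm]
        · rw [if_neg h, if_neg fun h' => h (Finset.mem_Icc.mp h').2, zero_mul]
    _ = ∑ t ∈ Finset.Icc 1 n, mysigma t * partcount (n - t) := by
        rw [Finset.sum_congr rfl fun d _ => Finset.sum_comm, Finset.sum_comm]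
        refine Finset.sum_congr rfl fun t ht => ?_
        rw [mysigma_eq_sum_sum_ite ht, Finset.sum_mul]
        refine Finset.sum_congr rfl fun d _ => ?_
        rw [Finset.sum_mul]
        exact Finset.sum_congr rfl fun m _ => by rw [ite_mul, zero_mul]
    _ = ∑ t ∈ Finset.range (n + 1), mysigma t * partcount (n - t) := by
        refine Finset.sum_subset (fun t ht => ?_) fun t ht ht' => ?_
        · rw [Finset.mem_Icc] at ht
          exact Finset.mem_range.mpr (by omega)
        · rw [Finset.mem_range] at ht
          rw [Finset.mem_Icc] at ht'
          obtain rfl : t = 0 := by omega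
          simp [mysigma]
    _ = _ := (Finset.Nat.sum_antidiagonal_eq_sum_range_succ
        (fun i j => mysigma i * partcount j) n).symm

theorem pcolored_eq_coeff_pow (k n : ℕ) :
    pcolored k n = PowerSeries.coeff n (PowerSeries.mk partcount ^ k) := by
  induction k generalizing n with
  | zero => simp [pcolored, PowerSeries.coeff_one]
  | succ k ih =>
    rw [pow_succ, PowerSeries.coeff_mul, pcolored,
      Finset.Nat.sum_antidiagonal_eq_sum_range_succ_mk]
    exact Finset.sum_congr rfl fun j _ => by rw [ih, PowerSeries.coeff_mk]

open PowerSeries in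
theorem X_mul_derivative_mk (f : ℕ → ℕ) :
    X * d⁄dX ℕ (mk f) = mk fun n => n * f n := by
  ext n
  cases n with
  | zero => simp
  | succ n => rw [coeff_succ_X_mul, coeff_derivative, coeff_mk, coeff_mk, mul_comm]; simp

open PowerSeries in
theorem mul_pcolored_eq_sum (k n : ℕ) :
    n * pcolored k n = k * ∑ j ∈ Finset.range n, mysigma (n - j) * pcolored k j := by
  set F : PowerSeries ℕ := mk partcount with hF
  have hlog : X * d⁄dX ℕ F = mk mysigma * F := by
    rw [hF, X_mul_derivative_mk]
    ext n
    rw [coeff_mk, coeff_mul, mul_partcount_eq_sum]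
    simp
  have hpow : X * d⁄dX ℕ (F ^ k) = (k : PowerSeries ℕ) * (F ^ k * mk mysigma) := by
    cases k with
    | zero => simp
    | succ k =>
      rw [derivative_pow, Nat.add_sub_cancel, pow_succ]
      calc _ = ((k + 1 : ℕ) : PowerSeries ℕ) * F ^ k * (X * d⁄dX ℕ F) := by ring
        _ = _ := by rw [hlog]; ring
  have hmk : F ^ k = mk (pcolored k) := by
    ext n
    rw [coeff_mk, pcolored_eq_coeff_pow]
  rw [hmk, X_mul_derivative_mk, ← nsmul_eq_mul] at hpow
  have := congrArg (coeff n) hpow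
  rw [coeff_mk, map_nsmul, coeff_mul, Finset.Nat.sum_antidiagonal_eq_sum_range_succ_mk,
    Finset.sum_range_succ] at this
  simpa [mysigma, mul_comm] using this

theorem mysigma_one : mysigma 1 = 1 := rfl

theorem mysigma_two : mysigma 2 = 3 := rfl

theorem mysigma_three : mysigma 3 = 4 := rfl

theorem mysigma_four : mysigma 4 = 7 := rfl

theorem mysigma_five : mysigma 5 = 6 := rfl

theorem mysigma_six : mysigma 6 = 12 := rfl

theorem pcolored_zero_right (k : ℕ) : pcolored k 0 = 1 := by
  simp [pcolored_eq_coeff_pow, partcount]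

theorem pcolored_one_right (k : ℕ) : pcolored k 1 = k := by
  simpa [pcolored_zero_right, mysigma] using mul_pcolored_eq_sum k 1

theorem two_mul_pcolored_two_right (k : ℕ) : 2 * pcolored k 2 = k * (k + 3) := by
  rw [mul_pcolored_eq_sum, Finset.sum_range_succ, Finset.sum_range_one, pcolored_zero_right,
    pcolored_one_right]
  simp only [Nat.reduceSub, mysigma_one, mysigma_two]
  ring

theorem le_mysigma (n : ℕ) : n ≤ mysigma n := by
  rcases Nat.eq_zero_or_pos n with rfl | hn
  · exact Nat.zero_le _
  · exact Finset.single_le_sum (f := fun d => d) (fun _ _ => Nat.zero_le _)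
      (Nat.mem_divisors_self n hn.ne')

theorem two_mul_mysigma_le (n : ℕ) : 2 * mysigma n ≤ n * (n + 1) := by
  have hsub : n.divisors ⊆ Finset.range (n + 1) := fun d hd =>
    Finset.mem_range.mpr (Nat.lt_succ_of_le (Nat.divisor_le hd))
  have h := Finset.sum_le_sum_of_subset (f := fun d => d) hsub
  have hr := Finset.sum_range_id_mul_two (n + 1)
  rw [Nat.add_sub_cancel] at hr
  rw [mysigma]
  linarith

theorem six_mul_sum_sq_add_one (n : ℕ) :
    6 * ∑ j ∈ Finset.range (n + 1), (j ^ 2 + 1) = n * (n + 1) * (2 * n + 1) + 6 * (n + 1) := by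
  induction n with
  | zero => simp
  | succ n ih => rw [Finset.sum_range_succ, mul_add, ih]; ring

theorem twelve_mul_sum_sub_mul_sq_add_one (n : ℕ) :
    12 * ∑ j ∈ Finset.range n, (n - j) * (j ^ 2 + 1) = n ^ 4 + 5 * n ^ 2 + 6 * n := by
  induction n with
  | zero => simp
  | succ n ih =>
    have h : ∑ j ∈ Finset.range (n + 1), (n + 1 - j) * (j ^ 2 + 1) =
        ∑ j ∈ Finset.range (n + 1), (n - j) * (j ^ 2 + 1) +
          ∑ j ∈ Finset.range (n + 1), (j ^ 2 + 1) := by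
      rw [← Finset.sum_add_distrib]
      refine Finset.sum_congr rfl fun j hj => ?_
      rw [Nat.succ_sub (Nat.lt_succ_iff.mp (Finset.mem_range.mp hj)), Nat.succ_mul]
    rw [h, Finset.sum_range_succ (fun j => (n - j) * (j ^ 2 + 1)), Nat.sub_self]
    linear_combination ih + 2 * six_mul_sum_sq_add_one n

section LowerBounds

variable {k : ℕ}

theorem two_mul_sum_le_mul_pcolored (hk : 2 ≤ k) (n : ℕ) :
    2 * ∑ j ∈ Finset.range n, mysigma (n - j) * pcolored k j ≤ n * pcolored k n := by
  rw [mul_pcolored_eq_sum]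
  exact Nat.mul_le_mul_right _ hk

theorem five_le_pcolored_two (hk : 2 ≤ k) : 5 ≤ pcolored k 2 := by
  have := two_mul_pcolored_two_right k
  nlinarith

theorem ten_le_pcolored_three (hk : 2 ≤ k) : 10 ≤ pcolored k 3 := by
  have h := two_mul_sum_le_mul_pcolored hk 3
  simp only [Finset.sum_range_succ, Finset.sum_range_zero, Nat.reduceSub, mysigma_one, mysigma_two,
    mysigma_three, pcolored_zero_right, pcolored_one_right] at h
  have := five_le_pcolored_two hk
  omega

theorem twenty_le_pcolored_four (hk : 2 ≤ k) : 20 ≤ pcolored k 4 := by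
  have h := two_mul_sum_le_mul_pcolored hk 4
  simp only [Finset.sum_range_succ, Finset.sum_range_zero, Nat.reduceSub, mysigma_one, mysigma_two,
    mysigma_three, mysigma_four, pcolored_zero_right, pcolored_one_right] at h
  have := five_le_pcolored_two hk
  have := ten_le_pcolored_three hk
  omega

theorem thirty_six_le_pcolored_five (hk : 2 ≤ k) : 36 ≤ pcolored k 5 := by
  have h := two_mul_sum_le_mul_pcolored hk 5
  simp only [Finset.sum_range_succ, Finset.sum_range_zero, Nat.reduceSub, mysigma_one, mysigma_two,
    mysigma_three, mysigma_four, mysigma_five, pcolored_zero_right, pcolored_one_right] at h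
  have := five_le_pcolored_two hk
  have := ten_le_pcolored_three hk
  have := twenty_le_pcolored_four hk
  omega

theorem sixty_five_le_pcolored_six (hk : 2 ≤ k) : 65 ≤ pcolored k 6 := by
  have h := two_mul_sum_le_mul_pcolored hk 6
  simp only [Finset.sum_range_succ, Finset.sum_range_zero, Nat.reduceSub, mysigma_one, mysigma_two,
    mysigma_three, mysigma_four, mysigma_five, mysigma_six, pcolored_zero_right,
    pcolored_one_right] at h
  have := five_le_pcolored_two hk
  have := ten_le_pcolored_three hk
  have := twenty_le_pcolored_four hk
  have := thirty_six_le_pcolored_five hk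
  omega

theorem cube_le_six_mul_pcolored_of_sq_le (hk : 2 ≤ k) {n : ℕ}
    (h : ∀ m < n, m ^ 2 + 1 ≤ pcolored k m) : n ^ 3 + 5 * n + 6 ≤ 6 * pcolored k n := by
  rcases Nat.eq_zero_or_pos n with rfl | hn
  · simp [pcolored_zero_right]
  · have hsum : ∑ j ∈ Finset.range n, (n - j) * (j ^ 2 + 1) ≤
        ∑ j ∈ Finset.range n, mysigma (n - j) * pcolored k j :=
      Finset.sum_le_sum fun j hj =>
        Nat.mul_le_mul (le_mysigma _) (h j (Finset.mem_range.mp hj))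
    have hrec := two_mul_sum_le_mul_pcolored hk n
    have hclosed := twelve_mul_sum_sub_mul_sq_add_one n
    refine Nat.le_of_mul_le_mul_left ?_ hn
    nlinarith

theorem sq_add_one_le_pcolored (hk : 2 ≤ k) (n : ℕ) : n ^ 2 + 1 ≤ pcolored k n := by
  induction n using Nat.strong_induction_on with
  | _ n ih =>
    have hcube := cube_le_six_mul_pcolored_of_sq_le hk ih
    rcases lt_or_ge n 5 with hn | hn
    · interval_cases n
      · omega
      · omega
      · exact five_le_pcolored_two hk
      · exact ten_le_pcolored_three hk
      · have := twenty_le_pcolored_four hk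
        omega
    · obtain ⟨m, rfl⟩ := Nat.exists_eq_add_of_le hn
      nlinarith [sq_nonneg m, Nat.zero_le (m ^ 3)]

theorem sq_add_self_add_two_le_pcolored (hk : 2 ≤ k) {n : ℕ} (hn : 5 ≤ n) :
    n ^ 2 + n + 2 ≤ pcolored k n := by
  have hcube := cube_le_six_mul_pcolored_of_sq_le hk fun m (_ : m < n) =>
    sq_add_one_le_pcolored hk m
  rcases lt_or_ge n 7 with h7 | h7
  · interval_cases n
    · have := thirty_six_le_pcolored_five hk
      omega
    · have := sixty_five_le_pcolored_six hk
      omega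
  · obtain ⟨m, rfl⟩ := Nat.exists_eq_add_of_le h7
    nlinarith [sq_nonneg m, Nat.zero_le (m ^ 3)]

end LowerBounds

theorem mysigma_add_lt_pcolored_mul {k a i : ℕ} (hk : 2 ≤ k) (ha : 2 ≤ a) (hi : 1 ≤ i)
    (hia : i ≤ a) : mysigma (a + i) < pcolored k a * mysigma i := by
  rcases lt_or_ge a 4 with h4 | h4
  · have h2 := five_le_pcolored_two hk
    have h3 := ten_le_pcolored_three hk
    interval_cases a <;> interval_cases i <;>
      simp only [Nat.reduceAdd, mysigma_one, mysigma_two, mysigma_three, mysigma_four,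
        mysigma_five, mysigma_six] <;> omega
  · have hσ := two_mul_mysigma_le (a + i)
    have hp := sq_add_one_le_pcolored hk a
    have hprod := Nat.mul_le_mul hp (le_mysigma i)
    suffices (a + i) * (a + i + 1) < 2 * ((a ^ 2 + 1) * i) by omega
    obtain ⟨s, rfl⟩ := Nat.exists_eq_add_of_le h4
    obtain ⟨t, rfl⟩ := Nat.exists_eq_add_of_le hi
    nlinarith [Nat.mul_le_mul hia (Nat.zero_le s), mul_nonneg (Nat.zero_le s) (Nat.zero_le t),
      mul_nonneg (Nat.zero_le t) (sq_nonneg s)]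

/-- Splitting the recurrence for `pcolored k (a + b)` after its first `b` terms, and bounding the
remaining ones by an approximate product inequality. -/
theorem add_mul_pcolored_add_le {k a b : ℕ} (e : ℕ → ℕ)
    (h : ∀ j < a, pcolored k (j + b) ≤ pcolored k j * pcolored k b + e j) :
    (a + b) * pcolored k (a + b) ≤ a * (pcolored k a * pcolored k b) +
      k * ∑ j ∈ Finset.range a, mysigma (a - j) * e j +
      k * ∑ i ∈ Finset.range b, mysigma (a + (b - i)) * pcolored k i := by
  have hsum : ∑ j ∈ Finset.range a, mysigma (a - j) * pcolored k (j + b) ≤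
      (∑ j ∈ Finset.range a, mysigma (a - j) * pcolored k j) * pcolored k b +
        ∑ j ∈ Finset.range a, mysigma (a - j) * e j := by
    rw [Finset.sum_mul, ← Finset.sum_add_distrib]
    refine Finset.sum_le_sum fun j hj => ?_
    calc _ ≤ mysigma (a - j) * (pcolored k j * pcolored k b + e j) :=
          Nat.mul_le_mul_left _ (h j (Finset.mem_range.mp hj))
      _ = _ := by ring
  have hsplit : ∑ j ∈ Finset.range (a + b), mysigma (a + b - j) * pcolored k j =
      ∑ i ∈ Finset.range b, mysigma (a + (b - i)) * pcolored k i +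
        ∑ j ∈ Finset.range a, mysigma (a - j) * pcolored k (j + b) := by
    rw [add_comm a b, Finset.sum_range_add]
    congr 1
    · refine Finset.sum_congr rfl fun i hi => ?_
      rw [Finset.mem_range] at hi
      rw [show b + a - i = a + (b - i) by omega]
    · refine Finset.sum_congr rfl fun j _ => ?_
      rw [show b + a - (b + j) = a - j by omega, add_comm b j]
  have hk := Nat.mul_le_mul_left k hsum
  rw [mul_pcolored_eq_sum, hsplit, ← mul_assoc a, mul_pcolored_eq_sum]
  linarith

theorem pcolored_add_lt_mul_of_forall_le {k a b : ℕ} (hk : 2 ≤ k) (ha : 2 ≤ a) (hb : 0 < b)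
    (hba : b ≤ a) (h : ∀ j < a, pcolored k (j + b) ≤ pcolored k j * pcolored k b) :
    pcolored k (a + b) < pcolored k a * pcolored k b := by
  have hle := add_mul_pcolored_add_le (fun _ => 0) h
  simp only [mul_zero, Finset.sum_const_zero, add_zero] at hle
  have hlt : ∑ i ∈ Finset.range b, mysigma (a + (b - i)) * pcolored k i <
      pcolored k a * ∑ i ∈ Finset.range b, mysigma (b - i) * pcolored k i := by
    rw [Finset.mul_sum]
    refine Finset.sum_lt_sum_of_nonempty (Finset.nonempty_range_iff.mpr hb.ne') fun i hi => ?_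
    rw [Finset.mem_range] at hi
    rw [← mul_assoc]
    refine Nat.mul_lt_mul_of_pos_right ?_ ?_
    · exact mysigma_add_lt_pcolored_mul hk ha (by omega) (by omega)
    · exact (Nat.succ_pos _).trans_le (sq_add_one_le_pcolored hk i)
  have hmul := Nat.mul_lt_mul_of_pos_left hlt (show 0 < k by omega)
  have hrec := mul_pcolored_eq_sum k b
  refine Nat.lt_of_mul_lt_mul_left (a := a + b) ?_
  calc _ ≤ _ := hle
    _ < a * (pcolored k a * pcolored k b) +
        k * (pcolored k a * ∑ i ∈ Finset.range b, mysigma (b - i) * pcolored k i) := by omega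
    _ = _ := by linear_combination pcolored k a * hrec.symm

theorem pcolored_add_le_mul_of_three_le {k : ℕ} (hk : 3 ≤ k) (a b : ℕ) :
    pcolored k (a + b) ≤ pcolored k a * pcolored k b := by
  induction hn : a + b using Nat.strong_induction_on generalizing a b with
  | _ n ih =>
    subst hn
    wlog hba : b ≤ a generalizing a b
    · rw [add_comm a b, mul_comm]
      exact this b a (fun m hm => ih m (by omega)) (by omega)
    rcases Nat.eq_zero_or_pos b with rfl | hb
    · simp [pcolored_zero_right]
    rcases lt_or_ge a 2 with ha | ha
    · obtain rfl : a = 1 := by omega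
      obtain rfl : b = 1 := by omega
      have := two_mul_pcolored_two_right k
      rw [pcolored_one_right]
      nlinarith
    · exact (pcolored_add_lt_mul_of_forall_le (by omega) ha hb hba fun j hj =>
        ih (j + b) (by omega) j b rfl).le

theorem pcolored_two_two : pcolored 2 2 = 5 := by
  have := two_mul_pcolored_two_right 2
  omega

theorem pcolored_two_three : pcolored 2 3 = 10 := by
  have h := mul_pcolored_eq_sum 2 3
  simp only [Finset.sum_range_succ, Finset.sum_range_zero, Nat.reduceSub, mysigma_one, mysigma_two,
    mysigma_three, pcolored_zero_right, pcolored_one_right, pcolored_two_two] at h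
  omega

theorem pcolored_two_four : pcolored 2 4 = 20 := by
  have h := mul_pcolored_eq_sum 2 4
  simp only [Finset.sum_range_succ, Finset.sum_range_zero, Nat.reduceSub, mysigma_one, mysigma_two,
    mysigma_three, mysigma_four, pcolored_zero_right, pcolored_one_right, pcolored_two_two,
    pcolored_two_three] at h
  omega

theorem mysigma_succ_add_mysigma_pred_lt_pcolored {a : ℕ} (ha : 4 ≤ a) :
    mysigma (a + 1) + mysigma (a - 1) < pcolored 2 a := by
  rcases Nat.eq_or_lt_of_le ha with rfl | h5
  · rw [pcolored_two_four]
    exact (by decide : 6 + 4 < 20)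
  · have h := sq_add_self_add_two_le_pcolored le_rfl h5
    have h₁ := two_mul_mysigma_le (a + 1)
    have h₂ := two_mul_mysigma_le (a - 1)
    obtain ⟨s, rfl⟩ := Nat.exists_eq_add_of_le' ha
    rw [show s + 4 - 1 = s + 3 by omega] at h₂ ⊢
    nlinarith

theorem pcolored_two_succ_lt {a : ℕ} (ha : 4 ≤ a) : pcolored 2 (a + 1) < pcolored 2 a * 2 := by
  induction a using Nat.strong_induction_on with
  | _ a ih =>
    have hle := add_mul_pcolored_add_le (k := 2) (a := a) (b := 1)
      (fun j => if j = 1 then 1 else 0) fun j hj => by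
        rw [pcolored_one_right]
        rcases lt_or_ge j 4 with h4 | h4
        · interval_cases j <;>
            simp [pcolored_zero_right, pcolored_one_right, pcolored_two_two, pcolored_two_three,
              pcolored_two_four]
        · exact (ih j hj h4).le.trans (Nat.le_add_right _ _)
    have hσ := mysigma_succ_add_mysigma_pred_lt_pcolored ha
    have hdefect : ∑ j ∈ Finset.range a, mysigma (a - j) * (if j = 1 then 1 else 0) =
        mysigma (a - 1) := by
      simp only [mul_ite, mul_one, mul_zero, Finset.sum_ite_eq', Finset.mem_range]
      exact if_pos (by omega)
    rw [hdefect, Finset.sum_range_one, pcolored_zero_right, pcolored_one_right, mul_one] at hle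
    refine Nat.lt_of_mul_lt_mul_left (a := a + 1) ?_
    linarith

theorem pcolored_two_succ_le {a : ℕ} (ha : 2 ≤ a) : pcolored 2 (a + 1) ≤ pcolored 2 a * 2 := by
  rcases lt_or_ge a 4 with h4 | h4
  · interval_cases a <;> simp [pcolored_two_two, pcolored_two_three, pcolored_two_four]
  · exact (pcolored_two_succ_lt h4).le

theorem pcolored_two_add_lt {a b : ℕ} (ha : 2 ≤ a) (hb : 2 ≤ b) :
    pcolored 2 (a + b) < pcolored 2 a * pcolored 2 b := by
  induction hn : a + b using Nat.strong_induction_on generalizing a b with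
  | _ n ih =>
    subst hn
    wlog hba : b ≤ a generalizing a b
    · rw [add_comm a b, mul_comm]
      exact this hb ha (fun m hm => ih m (by omega)) (by omega)
    refine pcolored_add_lt_mul_of_forall_le le_rfl ha (by omega) hba fun j hj => ?_
    obtain rfl | rfl | hj2 : j = 0 ∨ j = 1 ∨ 2 ≤ j := by omega
    · simp [pcolored_zero_right]
    · rw [pcolored_one_right, add_comm, mul_comm]
      exact pcolored_two_succ_le hb
    · exact (ih (j + b) (by omega) hj2 hb rfl).le

/-- Chern–Fu–Tang theorem for k-colored partitions. -/
theorem chern_fu_tang (k a b : ℕ) (hk : 2 ≤ k) (ha : 0 < a) (hb : 0 < b)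
    (hex : (a, b, k) ∉ ({(1, 1, 2), (1, 2, 2), (2, 1, 2), (1, 3, 2), (3, 1, 2), (1, 1, 3)} :
      Set (ℕ × ℕ × ℕ))) :
    pcolored k a * pcolored k b > pcolored k (a + b) := by
  simp only [Set.mem_insert_iff, Set.mem_singleton_iff, Prod.mk.injEq] at hex
  rw [gt_iff_lt]
  wlog hba : b ≤ a generalizing a b
  · rw [add_comm a b, mul_comm]
    exact this b a hb ha (by omega) (by omega)
  rcases Nat.eq_or_lt_of_le hk with rfl | hk3
  · obtain rfl | hb2 : b = 1 ∨ 2 ≤ b := by omega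
    · rw [pcolored_one_right]
      exact pcolored_two_succ_lt (by omega)
    · exact pcolored_two_add_lt (hb2.trans hba) hb2
  · rcases lt_or_ge a 2 with ha2 | ha2
    · obtain rfl : a = 1 := by omega
      obtain rfl : b = 1 := by omega
      have hk4 : 4 ≤ k := by omega
      have := two_mul_pcolored_two_right k
      rw [pcolored_one_right]
      nlinarith
    · exact pcolored_add_lt_mul_of_forall_le hk ha2 hb hba fun j _ =>
        pcolored_add_le_mul_of_three_le hk3 j b
end

section
/- Let P_n(x) be the D'Arcais polynomials. For all positive integers a, b with a + b > 4 and all real x > 1.8, P_a(x) · P_b(x) > P_{a+b}(x). -/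
theorem mysigma_ge (n : ℕ) (hn : 0 < n) : n ≤ mysigma n :=
  Finset.single_le_sum (f := fun d => d) (fun _ _ => Nat.zero_le _)
    (Nat.mem_divisors_self n hn.ne')

theorem cast_mysigma_ge (n : ℕ) (hn : 0 < n) : (n : ℝ) ≤ mysigma n :=
  mod_cast mysigma_ge n hn

theorem cast_mysigma_le (n : ℕ) : (mysigma n : ℝ) ≤ n * (n + 1) / 2 := by
  have h : ((2 * mysigma n : ℕ) : ℝ) ≤ ((n * (n + 1) : ℕ) : ℝ) :=
    mod_cast two_mul_mysigma_le n
  push_cast at h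
  linarith

theorem P_zero (x : ℝ) : P 0 x = 1 := by
  simp [P]

theorem P_succ (n : ℕ) (x : ℝ) :
    P (n + 1) x =
      x / (n + 1) * ∑ k ∈ Finset.range (n + 1), (mysigma (k + 1) : ℝ) * P (n - k) x := by
  rw [P]

theorem natCast_mul_P (n : ℕ) (x : ℝ) :
    n * P n x = x * ∑ j ∈ Finset.range n, (mysigma (n - j) : ℝ) * P j x := by
  cases n with
  | zero => simp
  | succ n =>
    rw [P_succ, ← Finset.sum_range_reflect (fun j => (mysigma (n + 1 - j) : ℝ) * P j x)]
    have hn : (n : ℝ) + 1 ≠ 0 := by positivity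
    have hs : ∑ k ∈ Finset.range (n + 1), (mysigma (k + 1) : ℝ) * P (n - k) x =
        ∑ j ∈ Finset.range (n + 1),
          (mysigma (n + 1 - (n + 1 - 1 - j)) : ℝ) * P (n + 1 - 1 - j) x := by
      refine Finset.sum_congr rfl fun j hj => ?_
      rw [Finset.mem_range] at hj
      rw [show n + 1 - (n + 1 - 1 - j) = j + 1 by omega, show n + 1 - 1 - j = n - j by omega]
    rw [← hs]
    push_cast
    field_simp

theorem P_pos (n : ℕ) {x : ℝ} (hx : 0 < x) : 0 < P n x := by
  induction n using Nat.strong_induction_on with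
  | _ n ih =>
    cases n with
    | zero => simp [P_zero]
    | succ n =>
      rw [P_succ]
      have hs : 0 < ∑ k ∈ Finset.range (n + 1), (mysigma (k + 1) : ℝ) * P (n - k) x := by
        refine Finset.sum_pos (fun k _ => mul_pos ?_ (ih _ (by omega))) ⟨0, by simp⟩
        exact_mod_cast (Nat.succ_pos k).trans_le (mysigma_ge (k + 1) k.succ_pos)
      positivity

theorem mysigma_seven : mysigma 7 = 8 := by
  decide

theorem mysigma_eight : mysigma 8 = 15 := by
  decide

theorem mysigma_nine : mysigma 9 = 13 := by
  decide

theorem mysigma_ten : mysigma 10 = 18 := by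
  decide

theorem mysigma_eleven : mysigma 11 = 12 := by
  decide

theorem P_one (x : ℝ) : P 1 x = x := by
  norm_num [P_succ, P_zero, mysigma_one]

theorem P_two (x : ℝ) :
    P 2 x = (x ^ 2 + 3 * x) / 2 := by
  rw [P_succ]
  norm_num [Finset.sum_range_succ, P_zero, P_one, mysigma_one, mysigma_two]
  ring

theorem P_three (x : ℝ) :
    P 3 x = (x ^ 3 + 9 * x ^ 2 + 8 * x) / 6 := by
  rw [P_succ]
  norm_num [Finset.sum_range_succ, P_zero, P_one, P_two, mysigma_one, mysigma_two, mysigma_three]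
  ring

theorem P_four (x : ℝ) :
    P 4 x = (x ^ 4 + 18 * x ^ 3 + 59 * x ^ 2 + 42 * x) / 24 := by
  rw [P_succ]
  norm_num [Finset.sum_range_succ, P_zero, P_one, P_two, P_three, mysigma_one, mysigma_two,
    mysigma_three, mysigma_four]
  ring

theorem P_five (x : ℝ) :
    P 5 x = (x ^ 5 + 30 * x ^ 4 + 215 * x ^ 3 + 450 * x ^ 2 + 144 * x) / 120 := by
  rw [P_succ]
  norm_num [Finset.sum_range_succ, P_zero, P_one, P_two, P_three, P_four, mysigma_one,
    mysigma_two, mysigma_three, mysigma_four, mysigma_five]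
  ring

theorem P_six (x : ℝ) :
    P 6 x = (x ^ 6 + 45 * x ^ 5 + 565 * x ^ 4 + 2475 * x ^ 3 + 3394 * x ^ 2 + 1440 * x) / 720 := by
  rw [P_succ]
  norm_num [Finset.sum_range_succ, P_zero, P_one, P_two, P_three, P_four, P_five, mysigma_one,
    mysigma_two, mysigma_three, mysigma_four, mysigma_five, mysigma_six]
  ring

theorem P_seven (x : ℝ) :
    P 7 x = (x ^ 7 + 63 * x ^ 6 + 1225 * x ^ 5 + 9345 * x ^ 4 + 28294 * x ^ 3 + 30912 * x ^ 2 +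
      5760 * x) / 5040 := by
  rw [P_succ]
  norm_num [Finset.sum_range_succ, P_zero, P_one, P_two, P_three, P_four, P_five, P_six,
    mysigma_one, mysigma_two, mysigma_three, mysigma_four, mysigma_five, mysigma_six,
    mysigma_seven]
  ring

theorem P_eight (x : ℝ) :
    P 8 x = (x ^ 8 + 84 * x ^ 7 + 2338 * x ^ 6 + 27720 * x ^ 5 + 147889 * x ^ 4 +
      340116 * x ^ 3 + 293292 * x ^ 2 + 75600 * x) / 40320 := by
  rw [P_succ]
  norm_num [Finset.sum_range_succ, P_zero, P_one, P_two, P_three, P_four, P_five, P_six, P_seven,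
    mysigma_one, mysigma_two, mysigma_three, mysigma_four, mysigma_five, mysigma_six,
    mysigma_seven, mysigma_eight]
  ring

theorem P_nine (x : ℝ) :
    P 9 x = (x ^ 9 + 108 * x ^ 8 + 4074 * x ^ 7 + 69552 * x ^ 6 + 579369 * x ^ 5 +
      2341332 * x ^ 4 + 4335596 * x ^ 3 + 3032208 * x ^ 2 + 524160 * x) / 362880 := by
  rw [P_succ]
  norm_num [Finset.sum_range_succ, P_zero, P_one, P_two, P_three, P_four, P_five, P_six, P_seven,
    P_eight, mysigma_one, mysigma_two, mysigma_three, mysigma_four, mysigma_five, mysigma_six,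
    mysigma_seven, mysigma_eight, mysigma_nine]
  ring

theorem P_ten (x : ℝ) :
    P 10 x = (x ^ 10 + 135 * x ^ 9 + 6630 * x ^ 8 + 154350 * x ^ 7 + 1857513 * x ^ 6 +
      11744775 * x ^ 5 + 38049920 * x ^ 4 + 57773700 * x ^ 3 + 36290736 * x ^ 2 +
      6531840 * x) / 3628800 := by
  rw [P_succ]
  norm_num [Finset.sum_range_succ, P_zero, P_one, P_two, P_three, P_four, P_five, P_six, P_seven,
    P_eight, P_nine, mysigma_one, mysigma_two, mysigma_three, mysigma_four, mysigma_five,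
    mysigma_six, mysigma_seven, mysigma_eight, mysigma_nine, mysigma_ten]
  ring

theorem P_eleven (x : ℝ) :
    P 11 x = (x ^ 11 + 165 * x ^ 10 + 10230 * x ^ 9 + 311850 * x ^ 8 + 5133513 * x ^ 7 +
      47002725 * x ^ 6 + 237810320 * x ^ 5 + 636593100 * x ^ 4 + 831170736 * x ^ 3 +
      433762560 * x ^ 2 + 43545600 * x) / 39916800 := by
  rw [P_succ]
  norm_num [Finset.sum_range_succ, P_zero, P_one, P_two, P_three, P_four, P_five, P_six, P_seven,
    P_eight, P_nine, P_ten, mysigma_one, mysigma_two, mysigma_three, mysigma_four, mysigma_five,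
    mysigma_six, mysigma_seven, mysigma_eight, mysigma_nine, mysigma_ten, mysigma_eleven]
  ring

theorem exists_pos_shift {x : ℝ} (hx : 1.8 < x) : ∃ t : ℝ, 0 < t ∧ x = 9 / 5 + t :=
  ⟨x - 9 / 5, by norm_num at hx; linarith, by ring⟩

theorem P_one_gt {x : ℝ} (hx : 1.8 < x) : 1 < P 1 x := by
  obtain ⟨t, ht, rfl⟩ := exists_pos_shift hx
  rw [P_one, ← sub_pos]
  ring_nf
  positivity

theorem P_two_gt {x : ℝ} (hx : 1.8 < x) : 3 < P 2 x := by
  obtain ⟨t, ht, rfl⟩ := exists_pos_shift hx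
  rw [P_two, ← sub_pos]
  ring_nf
  positivity

theorem P_three_gt {x : ℝ} (hx : 1.8 < x) : 7 < P 3 x := by
  obtain ⟨t, ht, rfl⟩ := exists_pos_shift hx
  rw [P_three, ← sub_pos]
  ring_nf
  positivity

theorem P_four_gt {x : ℝ} (hx : 1.8 < x) : 15 < P 4 x := by
  obtain ⟨t, ht, rfl⟩ := exists_pos_shift hx
  rw [P_four, ← sub_pos]
  ring_nf
  positivity

theorem P_five_gt {x : ℝ} (hx : 1.8 < x) : 126/5 < P 5 x := by
  obtain ⟨t, ht, rfl⟩ := exists_pos_shift hx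
  rw [P_five, ← sub_pos]
  ring_nf
  positivity

theorem P_six_gt {x : ℝ} (hx : 1.8 < x) : 42 < P 6 x := by
  obtain ⟨t, ht, rfl⟩ := exists_pos_shift hx
  rw [P_six, ← sub_pos]
  ring_nf
  positivity

theorem P_seven_gt {x : ℝ} (hx : 1.8 < x) : 66 < P 7 x := by
  obtain ⟨t, ht, rfl⟩ := exists_pos_shift hx
  rw [P_seven, ← sub_pos]
  ring_nf
  positivity

theorem P_eight_gt {x : ℝ} (hx : 1.8 < x) : 99 < P 8 x := by
  obtain ⟨t, ht, rfl⟩ := exists_pos_shift hx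
  rw [P_eight, ← sub_pos]
  ring_nf
  positivity

theorem P_nine_gt {x : ℝ} (hx : 1.8 < x) : 143 < P 9 x := by
  obtain ⟨t, ht, rfl⟩ := exists_pos_shift hx
  rw [P_nine, ← sub_pos]
  ring_nf
  positivity

theorem P_ten_gt {x : ℝ} (hx : 1.8 < x) : 264 < P 10 x := by
  obtain ⟨t, ht, rfl⟩ := exists_pos_shift hx
  rw [P_ten, ← sub_pos]
  ring_nf
  positivity

theorem P_eleven_gt {x : ℝ} (hx : 1.8 < x) : 312 < P 11 x := by
  obtain ⟨t, ht, rfl⟩ := exists_pos_shift hx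
  rw [P_eleven, ← sub_pos]
  ring_nf
  positivity

theorem P_four_lt_mul_two {x : ℝ} (hx : 1.8 < x) :
    P 4 x < P 2 x * P 2 x := by
  obtain ⟨t, ht, rfl⟩ := exists_pos_shift hx
  rw [P_four, P_two, ← sub_pos]
  ring_nf
  positivity

theorem P_five_lt_mul_two {x : ℝ} (hx : 1.8 < x) :
    P 5 x < P 3 x * P 2 x := by
  obtain ⟨t, ht, rfl⟩ := exists_pos_shift hx
  rw [P_five, P_three, P_two, ← sub_pos]
  ring_nf
  positivity

theorem P_six_lt_mul_three {x : ℝ} (hx : 1.8 < x) :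
    P 6 x < P 3 x * P 3 x := by
  obtain ⟨t, ht, rfl⟩ := exists_pos_shift hx
  rw [P_six, P_three, ← sub_pos]
  ring_nf
  positivity

theorem P_five_lt_mul_one {x : ℝ} (hx : 1.8 < x) :
    P 5 x < P 4 x * P 1 x := by
  obtain ⟨t, ht, rfl⟩ := exists_pos_shift hx
  rw [P_five, P_four, P_one, ← sub_pos]
  ring_nf
  positivity

theorem P_six_lt_mul_one {x : ℝ} (hx : 1.8 < x) :
    P 6 x < P 5 x * P 1 x := by
  obtain ⟨t, ht, rfl⟩ := exists_pos_shift hx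
  rw [P_six, P_five, P_one, ← sub_pos]
  ring_nf
  positivity

theorem P_seven_lt_mul_one {x : ℝ} (hx : 1.8 < x) :
    P 7 x < P 6 x * P 1 x := by
  obtain ⟨t, ht, rfl⟩ := exists_pos_shift hx
  rw [P_seven, P_six, P_one, ← sub_pos]
  ring_nf
  positivity

theorem P_eight_lt_mul_one {x : ℝ} (hx : 1.8 < x) :
    P 8 x < P 7 x * P 1 x := by
  obtain ⟨t, ht, rfl⟩ := exists_pos_shift hx
  rw [P_eight, P_seven, P_one, ← sub_pos]
  ring_nf
  positivity

theorem P_nine_lt_mul_one {x : ℝ} (hx : 1.8 < x) :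
    P 9 x < P 8 x * P 1 x := by
  obtain ⟨t, ht, rfl⟩ := exists_pos_shift hx
  rw [P_nine, P_eight, P_one, ← sub_pos]
  ring_nf
  positivity

theorem P_ten_lt_mul_one {x : ℝ} (hx : 1.8 < x) :
    P 10 x < P 9 x * P 1 x := by
  obtain ⟨t, ht, rfl⟩ := exists_pos_shift hx
  rw [P_ten, P_nine, P_one, ← sub_pos]
  ring_nf
  positivity

theorem P_two_le_mul_one_add (x : ℝ) : P 2 x ≤ P 1 x * P 1 x + 9 / 8 := by
  rw [P_two, P_one]
  nlinarith [sq_nonneg (x - 3 / 2)]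

theorem P_three_le_mul_one_add {x : ℝ} (hx : 1.8 < x) :
    P 3 x ≤ P 2 x * P 1 x + 1 / 2 := by
  obtain ⟨t, ht, rfl⟩ := exists_pos_shift hx
  rw [P_three, P_two, P_one, ← sub_nonneg]
  ring_nf
  positivity

theorem P_four_le_mul_one_add {x : ℝ} (hx : 1.8 < x) :
    P 4 x ≤ P 3 x * P 1 x + 9 / 8 := by
  obtain ⟨t, ht, rfl⟩ := exists_pos_shift hx
  rw [P_four, P_three, P_one, ← sub_nonneg]
  ring_nf
  positivity

theorem sum_range_sub_mul_quartic (n : ℕ) (y : ℝ) :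
    ∑ j ∈ Finset.range n, (y - j) * (((j + 1) * (j + 2) * (j + 3) * (j + 4) : ℝ) / 120) =
      n * (n + 1) * (n + 2) * (n + 3) * (n + 4) * (6 * y - 5 * n + 5) / 3600 := by
  induction n with
  | zero => simp
  | succ n ih =>
    rw [Finset.sum_range_succ, ih]
    push_cast
    ring

theorem quartic_le_P (n : ℕ) {x : ℝ} (hx : 1.8 < x) :
    ((n + 1) * (n + 2) * (n + 3) * (n + 4) : ℝ) / 120 ≤ P n x := by
  induction n using Nat.strong_induction_on with
  | _ n ih =>
    rcases lt_or_ge n 12 with hn | hn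
    · interval_cases n
      · norm_num [P_zero]
      · have := P_one_gt hx
        norm_num
        linarith
      · have := P_two_gt hx
        norm_num
        linarith
      · have := P_three_gt hx
        norm_num
        linarith
      · have := P_four_gt hx
        norm_num
        linarith
      · have := P_five_gt hx
        norm_num
        linarith
      · have := P_six_gt hx
        norm_num
        linarith
      · have := P_seven_gt hx
        norm_num
        linarith
      · have := P_eight_gt hx
        norm_num
        linarith
      · have := P_nine_gt hx
        norm_num
        linarith
      · have := P_ten_gt hx
        norm_num
        linarith
      · have := P_eleven_gt hx
        norm_num
        linarith
    · have hx' : (9 / 5 : ℝ) < x := by norm_num at hx; linarith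
      have hn' : (12 : ℝ) ≤ n := mod_cast hn
      have hsum : ∑ j ∈ Finset.range n,
          ((n : ℝ) - j) * (((j + 1) * (j + 2) * (j + 3) * (j + 4) : ℝ) / 120) ≤
          ∑ j ∈ Finset.range n, (mysigma (n - j) : ℝ) * P j x := by
        refine Finset.sum_le_sum fun j hj => ?_
        rw [Finset.mem_range] at hj
        have h := cast_mysigma_ge (n - j) (by omega)
        rw [Nat.cast_sub hj.le] at h
        exact mul_le_mul h (ih j hj) (by positivity) (by positivity)
      rw [sum_range_sub_mul_quartic] at hsum
      refine le_of_mul_le_mul_left ?_ (show (0 : ℝ) < n by linarith)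
      rw [natCast_mul_P]
      set S := ∑ j ∈ Finset.range n, (mysigma (n - j) : ℝ) * P j x
      set q := (n : ℝ) * (n + 1) * (n + 2) * (n + 3) * (n + 4) with hq
      have hq0 : 0 < q := by positivity
      have hS : 0 ≤ S := le_trans (by nlinarith) hsum
      calc (n : ℝ) * ((n + 1) * (n + 2) * (n + 3) * (n + 4) / 120) = q / 120 := by rw [hq]; ring
        _ ≤ 9 / 5 * (q * (6 * n - 5 * n + 5) / 3600) := by nlinarith
        _ ≤ 9 / 5 * S := by linarith
        _ ≤ x * S := mul_le_mul_of_nonneg_right hx'.le hS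

theorem quadratic_lt_P {n : ℕ} (hn : 4 ≤ n) {x : ℝ} (hx : 1.8 < x) :
    ((n + 1) * (n + 2) : ℝ) / 2 < P n x := by
  rcases hn.eq_or_lt with rfl | hn
  · have := P_four_gt hx
    norm_num
    linarith
  · have hn' : (5 : ℝ) ≤ n := mod_cast hn
    refine lt_of_lt_of_le ?_ (quartic_le_P n hx)
    have : (0 : ℝ) < (n + 1) * (n + 2) := by positivity
    nlinarith [mul_pos this (show (0 : ℝ) < (n + 3) * (n + 4) - 60 by nlinarith)]

theorem four_mul_quadratic_le_P {n : ℕ} (hn : 10 ≤ n) {x : ℝ} (hx : 1.8 < x) :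
    (2 * (n + 1) * (n + 2) : ℝ) ≤ P n x := by
  rcases lt_or_ge n 12 with h | h
  · interval_cases n
    · have := P_ten_gt hx
      norm_num
      linarith
    · have := P_eleven_gt hx
      norm_num
      linarith
  · have hn' : (12 : ℝ) ≤ n := mod_cast h
    refine le_trans ?_ (quartic_le_P n hx)
    have : (0 : ℝ) < (n + 1) * (n + 2) := by positivity
    nlinarith [mul_nonneg this.le (show (0 : ℝ) ≤ (n + 3) * (n + 4) - 240 by nlinarith)]

theorem add_mul_P_mul_sub_P_add (a b : ℕ) (x : ℝ) :
    ((a : ℝ) + b) * (P a x * P b x - P (a + b) x) =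
      x * (∑ j ∈ Finset.range a, (mysigma (a - j) : ℝ) * (P j x * P b x - P (j + b) x) +
        ∑ j ∈ Finset.range b, ((mysigma (b - j) : ℝ) * P a x - mysigma (a + b - j)) * P j x) := by
  have hab := natCast_mul_P (a + b) x
  rw [add_comm a b, Finset.sum_range_add] at hab
  have hs : ∑ j ∈ Finset.range a, (mysigma (b + a - (b + j)) : ℝ) * P (b + j) x =
      ∑ j ∈ Finset.range a, (mysigma (a - j) : ℝ) * P (j + b) x :=
    Finset.sum_congr rfl fun j _ => by rw [Nat.add_sub_add_left, add_comm b j]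
  rw [hs, add_comm b a] at hab
  push_cast at hab
  simp only [mul_sub, sub_mul, Finset.sum_sub_distrib, ← mul_assoc]
  rw [← Finset.sum_mul]
  have hb : ∑ j ∈ Finset.range b, (mysigma (b - j) : ℝ) * P a x * P j x =
      P a x * ∑ j ∈ Finset.range b, (mysigma (b - j) : ℝ) * P j x := by
    rw [Finset.mul_sum]
    exact Finset.sum_congr rfl fun j _ => by ring
  rw [hb]
  linear_combination P b x * natCast_mul_P a x + P a x * natCast_mul_P b x - hab

theorem mysigma_lt_mysigma_mul_P {a k : ℕ} (ha : 4 ≤ a) (hk : 0 < k) (hka : k ≤ a) {x : ℝ}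
    (hx : 1.8 < x) : (mysigma (a + k) : ℝ) < mysigma k * P a x := by
  have h1 := cast_mysigma_le (a + k)
  have h2 := cast_mysigma_ge k hk
  have h3 := quadratic_lt_P ha hx
  have hk' : (1 : ℝ) ≤ k := mod_cast hk
  have hka' : (k : ℝ) ≤ a := mod_cast hka
  push_cast at h1
  have h4 : ((a : ℝ) + k) * (a + k + 1) / 2 ≤ k * ((a + 1) * (a + 2) / 2) := by
    nlinarith [mul_nonneg (sub_nonneg.2 hk') (show (0 : ℝ) ≤ a * a + a - k by nlinarith)]
  calc (mysigma (a + k) : ℝ) ≤ k * ((a + 1) * (a + 2) / 2) := h1.trans h4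
    _ < k * P a x := by gcongr
    _ ≤ mysigma k * P a x := by
      have : 0 < P a x := lt_trans (by positivity) h3
      gcongr

theorem P_add_lt_mul_of_sum_pos {a b : ℕ} (ha : 0 < a) {x : ℝ} (hx : 0 < x)
    (h : 0 < ∑ j ∈ Finset.range a, (mysigma (a - j) : ℝ) * (P j x * P b x - P (j + b) x) +
        ∑ j ∈ Finset.range b, ((mysigma (b - j) : ℝ) * P a x - mysigma (a + b - j)) * P j x) :
    P (a + b) x < P a x * P b x := by
  have hpos := mul_pos hx h
  rw [← add_mul_P_mul_sub_P_add] at hpos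
  exact sub_pos.1 (pos_of_mul_pos_right hpos (by positivity))

theorem P_add_lt_mul_of_four_le {a b : ℕ} (hb : 4 ≤ b) (hba : b ≤ a) {x : ℝ} (hx : 1.8 < x)
    (ih : ∀ j < a, 0 < j → P (j + b) x < P j x * P b x) : P (a + b) x < P a x * P b x := by
  have hx0 : 0 < x := lt_trans (by norm_num) hx
  refine P_add_lt_mul_of_sum_pos (by omega) hx0 (add_pos_of_nonneg_of_pos ?_ ?_)
  · refine Finset.sum_nonneg fun j hj => mul_nonneg (Nat.cast_nonneg _) ?_
    rcases j.eq_zero_or_pos with rfl | hj0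
    · simp [P_zero]
    · exact (sub_pos.2 (ih j (Finset.mem_range.1 hj) hj0)).le
  · refine Finset.sum_pos (fun j hj => mul_pos ?_ (P_pos j hx0)) ⟨0, by simp; omega⟩
    rw [Finset.mem_range] at hj
    rw [Nat.add_sub_assoc hj.le]
    exact sub_pos.2 (mysigma_lt_mysigma_mul_P (by omega) (by omega) (by omega) hx)

theorem P_add_three_lt_mul {a : ℕ} (ha : 4 ≤ a) {x : ℝ} (hx : 1.8 < x)
    (ih : ∀ j < a, 2 ≤ j → P (j + 3) x < P j x * P 3 x) : P (a + 3) x < P a x * P 3 x := by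
  have hx0 : 0 < x := lt_trans (by norm_num) hx
  have ha' : (4 : ℝ) ≤ a := mod_cast ha
  refine P_add_lt_mul_of_sum_pos (by omega) hx0 ?_
  have hP := quadratic_lt_P ha hx
  have hlow : -(9 / 8) * (((a : ℝ) - 1) * a / 2) ≤
      ∑ j ∈ Finset.range a, (mysigma (a - j) : ℝ) * (P j x * P 3 x - P (j + 3) x) := by
    obtain ⟨m, rfl⟩ := Nat.exists_eq_add_of_le' (show 2 ≤ a by omega)
    rw [add_comm m 2, Finset.sum_range_add]
    have hrest : 0 ≤ ∑ j ∈ Finset.range m,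
        (mysigma (2 + m - (2 + j)) : ℝ) * (P (2 + j) x * P 3 x - P (2 + j + 3) x) :=
      Finset.sum_nonneg fun j hj => mul_nonneg (Nat.cast_nonneg _)
        (sub_pos.2 (ih (2 + j) (by have := Finset.mem_range.1 hj; omega) (by omega))).le
    have hs := cast_mysigma_le (2 + m - 1)
    rw [Nat.cast_sub (by omega)] at hs
    have hd := P_four_le_mul_one_add hx
    simp only [Finset.sum_range_succ, Finset.sum_range_zero, P_zero, one_mul, zero_add, sub_self,
      mul_zero]
    push_cast at hs ⊢
    have h0 : (0 : ℝ) ≤ mysigma (2 + m - 1) := Nat.cast_nonneg _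
    norm_num only [show 1 + 3 = 4 from rfl] at hd ⊢
    nlinarith [mul_nonneg h0 (show 0 ≤ P 1 x * P 3 x - P 4 x + 9 / 8 by linarith)]
  have h1 := mysigma_lt_mysigma_mul_P ha (k := 1) (by omega) (by omega) hx
  have h2 := mysigma_lt_mysigma_mul_P ha (k := 2) (by omega) (by omega) hx
  have h3 := mysigma_lt_mysigma_mul_P ha (k := 3) (by omega) (by omega) hx
  have hs := cast_mysigma_le (a + 3)
  simp only [Finset.sum_range_succ, Finset.sum_range_zero, P_zero]
  simp only [show 3 - 0 = 3 from rfl, show 3 - 1 = 2 from rfl, show 3 - 2 = 1 from rfl,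
    show a + 3 - 0 = a + 3 from rfl, show a + 3 - 1 = a + 2 from rfl,
    show a + 3 - 2 = a + 1 from rfl]
  have q1 := mul_pos (sub_pos.2 h1) (P_pos 2 hx0)
  have q2 := mul_pos (sub_pos.2 h2) (P_pos 1 hx0)
  rw [mysigma_three]
  push_cast at hs ⊢
  nlinarith

theorem P_add_two_lt_mul {a : ℕ} (ha : 4 ≤ a) {x : ℝ} (hx : 1.8 < x)
    (ih : ∀ j < a, 2 ≤ j → P (j + 2) x < P j x * P 2 x) : P (a + 2) x < P a x * P 2 x := by
  have hx0 : 0 < x := lt_trans (by norm_num) hx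
  have ha' : (4 : ℝ) ≤ a := mod_cast ha
  refine P_add_lt_mul_of_sum_pos (by omega) hx0 ?_
  have hP := quadratic_lt_P ha hx
  have hlow : -(1 / 2) * (((a : ℝ) - 1) * a / 2) ≤
      ∑ j ∈ Finset.range a, (mysigma (a - j) : ℝ) * (P j x * P 2 x - P (j + 2) x) := by
    obtain ⟨m, rfl⟩ := Nat.exists_eq_add_of_le' (show 2 ≤ a by omega)
    rw [add_comm m 2, Finset.sum_range_add]
    have hrest : 0 ≤ ∑ j ∈ Finset.range m,
        (mysigma (2 + m - (2 + j)) : ℝ) * (P (2 + j) x * P 2 x - P (2 + j + 2) x) :=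
      Finset.sum_nonneg fun j hj => mul_nonneg (Nat.cast_nonneg _)
        (sub_pos.2 (ih (2 + j) (by have := Finset.mem_range.1 hj; omega) (by omega))).le
    have hs := cast_mysigma_le (2 + m - 1)
    rw [Nat.cast_sub (by omega)] at hs
    have hd := P_three_le_mul_one_add hx
    simp only [Finset.sum_range_succ, Finset.sum_range_zero, P_zero, one_mul, zero_add, sub_self,
      mul_zero]
    push_cast at hs ⊢
    have h0 : (0 : ℝ) ≤ mysigma (2 + m - 1) := Nat.cast_nonneg _
    norm_num only [show 1 + 2 = 3 from rfl] at hd ⊢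
    nlinarith [mul_nonneg h0 (show 0 ≤ P 1 x * P 2 x - P 3 x + 1 / 2 by linarith)]
  have h1 := mysigma_lt_mysigma_mul_P ha (k := 1) (by omega) (by omega) hx
  have hs := cast_mysigma_le (a + 2)
  simp only [Finset.sum_range_succ, Finset.sum_range_zero, P_zero]
  simp only [show 2 - 0 = 2 from rfl, show 2 - 1 = 1 from rfl,
    show a + 2 - 0 = a + 2 from rfl, show a + 2 - 1 = a + 1 from rfl]
  have q1 := mul_pos (sub_pos.2 h1) (P_pos 1 hx0)
  rw [mysigma_two]
  push_cast at hs ⊢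
  nlinarith

theorem P_add_one_lt_mul {a : ℕ} (ha : 10 ≤ a) {x : ℝ} (hx : 1.8 < x)
    (ih : ∀ j < a, 4 ≤ j → P (j + 1) x < P j x * P 1 x) : P (a + 1) x < P a x * P 1 x := by
  have hx0 : 0 < x := lt_trans (by norm_num) hx
  have ha' : (10 : ℝ) ≤ a := mod_cast ha
  refine P_add_lt_mul_of_sum_pos (by omega) hx0 ?_
  have hP := four_mul_quadratic_le_P ha hx
  have hlow : -(9 / 8) * (((a : ℝ) - 1) * a / 2) - 1 / 2 * (((a : ℝ) - 2) * (a - 1) / 2) -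
        9 / 8 * (((a : ℝ) - 3) * (a - 2) / 2) ≤
      ∑ j ∈ Finset.range a, (mysigma (a - j) : ℝ) * (P j x * P 1 x - P (j + 1) x) := by
    obtain ⟨m, rfl⟩ := Nat.exists_eq_add_of_le' (show 4 ≤ a by omega)
    rw [add_comm m 4, Finset.sum_range_add]
    have hrest : 0 ≤ ∑ j ∈ Finset.range m,
        (mysigma (4 + m - (4 + j)) : ℝ) * (P (4 + j) x * P 1 x - P (4 + j + 1) x) :=
      Finset.sum_nonneg fun j hj => mul_nonneg (Nat.cast_nonneg _)
        (sub_pos.2 (ih (4 + j) (by have := Finset.mem_range.1 hj; omega) (by omega))).le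
    have hs1 := cast_mysigma_le (4 + m - 1)
    have hs2 := cast_mysigma_le (4 + m - 2)
    have hs3 := cast_mysigma_le (4 + m - 3)
    rw [Nat.cast_sub (by omega)] at hs1 hs2 hs3
    have hd1 := P_two_le_mul_one_add x
    have hd2 := P_three_le_mul_one_add hx
    have hd3 := P_four_le_mul_one_add hx
    simp only [Finset.sum_range_succ, Finset.sum_range_zero, P_zero, one_mul, zero_add, sub_self,
      mul_zero]
    push_cast at hs1 hs2 hs3 ⊢
    have h1 : (0 : ℝ) ≤ mysigma (4 + m - 1) := Nat.cast_nonneg _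
    have h2 : (0 : ℝ) ≤ mysigma (4 + m - 2) := Nat.cast_nonneg _
    have h3 : (0 : ℝ) ≤ mysigma (4 + m - 3) := Nat.cast_nonneg _
    norm_num only [show 1 + 1 = 2 from rfl, show 2 + 1 = 3 from rfl, show 3 + 1 = 4 from rfl]
    have m1 := mul_nonneg h1 (show 0 ≤ P 1 x * P 1 x - P 2 x + 9 / 8 by linarith)
    have m2 := mul_nonneg h2 (show 0 ≤ P 2 x * P 1 x - P 3 x + 1 / 2 by linarith)
    have m3 := mul_nonneg h3 (show 0 ≤ P 3 x * P 1 x - P 4 x + 9 / 8 by linarith)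
    linarith
  have hs := cast_mysigma_le (a + 1)
  simp only [Finset.sum_range_succ, Finset.sum_range_zero, P_zero]
  simp only [show 1 - 0 = 1 from rfl, show a + 1 - 0 = a + 1 from rfl]
  rw [mysigma_one]
  push_cast at hs ⊢
  nlinarith

theorem P_add_lt_mul_of_le {x : ℝ} (hx : 1.8 < x) {a b : ℕ} (hb : 0 < b) (hba : b ≤ a)
    (hab : 4 < a + b)
    (ih : ∀ j < a, 0 < j → 4 < j + b → P (j + b) x < P j x * P b x) :
    P (a + b) x < P a x * P b x := by
  rcases lt_or_ge b 4 with hb4 | hb4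
  · interval_cases b
    · rcases lt_or_ge a 10 with h | h
      · interval_cases a
        · omega
        · omega
        · omega
        · exact P_five_lt_mul_one hx
        · exact P_six_lt_mul_one hx
        · exact P_seven_lt_mul_one hx
        · exact P_eight_lt_mul_one hx
        · exact P_nine_lt_mul_one hx
        · exact P_ten_lt_mul_one hx
      · exact P_add_one_lt_mul h hx fun j hj hj4 => ih j hj (by omega) (by omega)
    · rcases lt_or_ge a 4 with h | h
      · obtain rfl : a = 3 := by omega
        exact P_five_lt_mul_two hx
      · refine P_add_two_lt_mul h hx fun j hj hj2 => ?_
        rcases hj2.eq_or_lt with rfl | hj2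
        · exact P_four_lt_mul_two hx
        · exact ih j hj (by omega) (by omega)
    · rcases lt_or_ge a 4 with h | h
      · obtain rfl : a = 3 := by omega
        exact P_six_lt_mul_three hx
      · exact P_add_three_lt_mul h hx fun j hj hj2 => ih j hj (by omega) (by omega)
  · exact P_add_lt_mul_of_four_le hb4 hba hx fun j hj hj0 => ih j hj hj0 (by omega)

theorem P_add_lt_mul {x : ℝ} (hx : 1.8 < x) (n a b : ℕ) (hn : a + b = n) (ha : 0 < a)
    (hb : 0 < b) (hab : 4 < a + b) : P (a + b) x < P a x * P b x := by
  induction n using Nat.strong_induction_on generalizing a b with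
  | _ n ih =>
    rcases le_total b a with h | h
    · exact P_add_lt_mul_of_le hx hb h hab fun j hj hj0 hjb =>
        ih (j + b) (by omega) j b rfl hj0 hb hjb
    · rw [add_comm, mul_comm]
      exact P_add_lt_mul_of_le hx ha h (by omega) fun j hj hj0 hja =>
        ih (j + a) (by omega) j a rfl hj0 ha hja

theorem darcais_BO_gt_one_point_eight (a b : ℕ) (ha : 0 < a) (hb : 0 < b) (hab : 4 < a + b)
    (x : ℝ) (hx : 1.8 < x) :
    P a x * P b x > P (a + b) x := by
  exact P_add_lt_mul hx _ a b rfl ha hb hab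
end
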